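/- Let d ≥ 1, a > 0, β > 1, δ ∈ [0,2) and γ > 0, and define ν(x) = e^{−a|x|^β} |x|^{−d−δ} (1 + |x|)^{d+δ−γ} for x ∈ ℝ^d \ {0}. Then ν does not satisfy condition (A3): for every constant C ≥ 1 there exist x, y ∈ ℝ^d with |y − x| ≥ 1 such that ∫_{{z : |z−x|>1/2, |z−y|>1/2}} ν(x−z) ν(z−y) dz > C ν(x−y). -/

import Mathlib

open MeasureTheory

lemma aux_theta (β : ℝ) (hβ : 1 < β) : ∃ θ : ℝ, 1/2 < θ ∧ θ < 1 ∧ 2 * θ ^ β < 1 := by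
  have h1 : (1/2:ℝ) < (1/2:ℝ) ^ (β⁻¹) := by
    have := Real.rpow_lt_rpow_of_exponent_gt (x := (1/2:ℝ)) (by norm_num) (by norm_num)
      (inv_lt_one_of_one_lt₀ hβ)
    simpa using this
  obtain ⟨θ, h2, h3⟩ := exists_between h1
  refine ⟨θ, h2, ?_, ?_⟩
  · refine h3.trans_le (Real.rpow_le_one (by norm_num) (by norm_num) (by positivity))
  · have h4 := Real.rpow_lt_rpow (by linarith) h3 (by linarith : 0 < β)
    rw [← Real.rpow_mul (by norm_num), inv_mul_cancel₀ (by linarith), Real.rpow_one] at h4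
    linarith

lemma aux_pow (β t : ℝ) (hβ : 1 < β) (ht : 0 ≤ t) : t - 1 ≤ t ^ β := by
  rcases le_total 1 t with h | h
  · have := Real.rpow_le_rpow_of_exponent_le h hβ.le
    rw [Real.rpow_one] at this
    linarith
  · have := Real.rpow_nonneg ht β
    linarith

/-- polynomial times exponential is bounded -/
lemma aux_bdd (a p : ℝ) (ha : 0 < a) :
    ∃ K : ℝ, 0 < K ∧ ∀ s : ℝ, 1 ≤ s → Real.exp (-(a * s)) * s ^ p ≤ K := by
  obtain ⟨n, hn⟩ := exists_nat_ge p
  refine ⟨n.factorial / a ^ n, by positivity, fun s hs => ?_⟩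
  have h1 : s ^ p ≤ s ^ n := by
    rw [← Real.rpow_natCast]
    exact Real.rpow_le_rpow_of_exponent_le hs hn
  have h2 := Real.pow_div_factorial_le_exp (a * s) (by positivity) n
  rw [div_le_iff₀ (by positivity), mul_pow] at h2
  rw [Real.exp_neg, le_div_iff₀ (by positivity), inv_mul_eq_div, div_mul_eq_mul_div,
    div_le_iff₀ (Real.exp_pos _)]
  have : s ^ p * a ^ n ≤ s ^ n * a ^ n := by gcongr
  linarith

lemma aux_large (c p V C : ℝ) (hc : 0 < c) (hV : 0 < V) (hC : 0 < C) (N : ℝ) :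
    ∃ R : ℝ, N ≤ R ∧ 0 ≤ R ∧ C * (Real.exp (-(c * (R - 1))) * (1 + R) ^ p) < V := by
  have h := (tendsto_rpow_mul_exp_neg_mul_atTop_nhds_zero p c hc)
  have h2 := h.eventually (gt_mem_nhds
    (show 0 < V / (C * Real.exp (2 * c)) by positivity))
  obtain ⟨s, hs1, hs2⟩ := (h2.and (Filter.eventually_ge_atTop (max N 0 + 1))).exists
  refine ⟨s - 1, by linarith [le_max_left N 0], by linarith [le_max_right N 0], ?_⟩
  rw [lt_div_iff₀ (by positivity)] at hs1
  have e : Real.exp (-(c * (s - 1 - 1))) = Real.exp (-c * s) * Real.exp (2 * c) := by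
    rw [← Real.exp_add]; ring_nf
  rw [e, show 1 + (s - 1) = s by ring]
  linarith

theorem stmt6 (d : ℕ) (hd : 1 ≤ d) (a β δ γ : ℝ)
    (ha : 0 < a) (hβ : 1 < β) (hδ0 : 0 ≤ δ) (hδ2 : δ < 2) (hγ : 0 < γ)
    (ν : EuclideanSpace ℝ (Fin d) → ℝ)
    (hν : ∀ x : EuclideanSpace ℝ (Fin d),
      ν x = Real.exp (-(a * ‖x‖ ^ β)) * ‖x‖ ^ (-(d : ℝ) - δ) * (1 + ‖x‖) ^ ((d : ℝ) + δ - γ)) :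
    ∀ C : ℝ, 1 ≤ C →
      ∃ x y : EuclideanSpace ℝ (Fin d), 1 ≤ ‖y - x‖ ∧
        C * ν (x - y) <
          ∫ z in {z : EuclideanSpace ℝ (Fin d) | 1/2 < ‖z - x‖ ∧ 1/2 < ‖z - y‖},
            ν (x - z) * ν (z - y) := by
  intro C hC
  have hνm : Measurable ν := by
    have : ν = fun x => Real.exp (-(a * ‖x‖ ^ β)) * ‖x‖ ^ (-(d : ℝ) - δ) *
      (1 + ‖x‖) ^ ((d : ℝ) + δ - γ) := funext hν
    rw [this]; fun_prop
  have hν0 : ∀ w, 0 ≤ ν w := fun w => by rw [hν]; positivity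
  -- upper bounds
  have hub : ∀ q : ℝ, ∃ K : ℝ, 0 < K ∧ ∀ w, 1/2 < ‖w‖ → ν w ≤ K * (1 + ‖w‖) ^ (-q) := by
    intro q
    obtain ⟨K, hK, hb⟩ := aux_bdd a ((d : ℝ) + δ - γ + q) ha
    refine ⟨Real.exp (2 * a) * (1/2:ℝ) ^ (-(d : ℝ) - δ) * K, by positivity, fun w hw => ?_⟩
    have h1 := hb (1 + ‖w‖) (by linarith)
    have h2 : Real.exp (-(a * ‖w‖ ^ β)) ≤ Real.exp (2 * a) * Real.exp (-(a * (1 + ‖w‖))) := by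
      rw [← Real.exp_add]
      apply Real.exp_le_exp.2
      have := mul_le_mul_of_nonneg_left (aux_pow β ‖w‖ hβ (norm_nonneg _)) ha.le
      linarith
    have h3 : ‖w‖ ^ (-(d : ℝ) - δ) ≤ (1/2:ℝ) ^ (-(d : ℝ) - δ) :=
      Real.rpow_le_rpow_of_nonpos (by norm_num) hw.le
        (by have : (0:ℝ) ≤ d := by positivity
            linarith)
    have hs : (1 + ‖w‖) ^ ((d : ℝ) + δ - γ) =
        (1 + ‖w‖) ^ ((d : ℝ) + δ - γ + q) * (1 + ‖w‖) ^ (-q) := by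
      rw [← Real.rpow_add (by positivity)]; ring_nf
    rw [hν, hs]
    calc _ ≤ (Real.exp (2 * a) * Real.exp (-(a * (1 + ‖w‖)))) * (1/2:ℝ) ^ (-(d : ℝ) - δ) *
          ((1 + ‖w‖) ^ ((d : ℝ) + δ - γ + q) * (1 + ‖w‖) ^ (-q)) := by gcongr
      _ = Real.exp (2 * a) * (1/2:ℝ) ^ (-(d : ℝ) - δ) *
          (Real.exp (-(a * (1 + ‖w‖))) * (1 + ‖w‖) ^ ((d : ℝ) + δ - γ + q)) *
            (1 + ‖w‖) ^ (-q) := by ring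
      _ ≤ _ := by gcongr
  -- lower bound
  have hlb : ∀ w s, 0 < ‖w‖ → ‖w‖ ≤ s → Real.exp (-(a * s ^ β)) * (1 + s) ^ (-γ) ≤ ν w := by
    intro w s hw hs
    have h3 : (1 + ‖w‖) ^ (-(d : ℝ) - δ) ≤ ‖w‖ ^ (-(d : ℝ) - δ) :=
      Real.rpow_le_rpow_of_nonpos hw (by linarith)
        (by have : (0:ℝ) ≤ d := by positivity
            linarith)
    have h4 : (1 + s) ^ (-γ) ≤ (1 + ‖w‖) ^ (-γ) :=
      Real.rpow_le_rpow_of_nonpos (by linarith) (by linarith) (by linarith)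
    have h5 : (1 + ‖w‖) ^ (-γ) = (1 + ‖w‖) ^ (-(d : ℝ) - δ) * (1 + ‖w‖) ^ ((d : ℝ) + δ - γ) := by
      rw [← Real.rpow_add (by positivity)]; ring_nf
    have h6 : Real.exp (-(a * s ^ β)) ≤ Real.exp (-(a * ‖w‖ ^ β)) := by
      apply Real.exp_le_exp.2
      gcongr
    rw [hν, mul_assoc]
    calc _ ≤ Real.exp (-(a * ‖w‖ ^ β)) * (1 + ‖w‖) ^ (-γ) := by
            have : 0 ≤ 1 + s := by linarith
            gcongr
      _ ≤ _ := by rw [h5]; gcongr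
  obtain ⟨θ, hθ1, hθ2, hθ3⟩ := aux_theta β hβ
  set V := (volume (Metric.ball (0 : EuclideanSpace ℝ (Fin d)) 1)).toReal with hVdef
  have hV : 0 < V := ENNReal.toReal_pos (Metric.measure_ball_pos _ _ one_pos).ne'
    measure_ball_lt_top.ne
  obtain ⟨R, hRN, hR0, hR⟩ := aux_large (a * (1 - 2 * θ ^ β)) ((d:ℝ) + δ + 2 * γ) V C
    (mul_pos ha (by linarith)) hV (by linarith) (max 4 (1 / (θ - 1/2)))
  have hR4 : 4 ≤ R := (le_max_left _ _).trans hRN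
  have hRθ : R / 2 + 1 ≤ θ * R := by
    have := (le_max_right _ _).trans hRN
    rw [div_le_iff₀ (by linarith)] at this
    linarith
  set x : EuclideanSpace ℝ (Fin d) := EuclideanSpace.single ⟨0, hd⟩ R with hx
  have hxn : ‖x‖ = R := by rw [hx]; simp [abs_of_nonneg hR0]
  refine ⟨x, 0, by rw [zero_sub, norm_neg, hxn]; linarith, ?_⟩
  simp only [sub_zero]
  set S := {z : EuclideanSpace ℝ (Fin d) | 1/2 < ‖z - x‖ ∧ 1/2 < ‖z‖} with hS
  have hSm : MeasurableSet S := by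
    have h1 : MeasurableSet {z : EuclideanSpace ℝ (Fin d) | 1/2 < ‖z - x‖} :=
      measurableSet_lt measurable_const (by fun_prop)
    have h2 : MeasurableSet {z : EuclideanSpace ℝ (Fin d) | 1/2 < ‖z‖} :=
      measurableSet_lt measurable_const (by fun_prop)
    exact h1.inter h2
  -- integrability
  have hint : IntegrableOn (fun z => ν (x - z) * ν z) S := by
    obtain ⟨K₁, hK₁, hb₁⟩ := hub 0
    obtain ⟨K₂, hK₂, hb₂⟩ := hub ((d:ℝ) + 1)
    have hg : Integrable (fun z : EuclideanSpace ℝ (Fin d) =>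
        K₁ * (K₂ * (1 + ‖z‖) ^ (-((d:ℝ) + 1)))) :=
      ((integrable_one_add_norm (by simp)).const_mul _).const_mul _
    refine Integrable.mono' hg.integrableOn
      (Measurable.aestronglyMeasurable (by fun_prop)) ?_
    filter_upwards [ae_restrict_mem hSm] with z hz
    rw [Real.norm_of_nonneg (mul_nonneg (hν0 _) (hν0 _))]
    have h1 := hb₁ (x - z) (by rw [norm_sub_rev]; exact hz.1)
    have h2 := hb₂ z hz.2
    simp only [neg_zero, Real.rpow_zero, mul_one] at h1
    exact mul_le_mul h1 h2 (hν0 _) hK₁.le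
  -- the ball
  set B := Metric.ball ((1/2:ℝ) • x) 1 with hB
  have hhalf : ‖(1/2:ℝ) • x‖ = R / 2 := by rw [norm_smul, hxn]; norm_num; ring
  have hBz : ∀ z ∈ B, (1/2 < ‖x - z‖ ∧ ‖x - z‖ ≤ θ * R) ∧ (1/2 < ‖z‖ ∧ ‖z‖ ≤ θ * R) := by
    intro z hz
    rw [hB, Metric.mem_ball, dist_eq_norm] at hz
    have e : x - z = (1/2:ℝ) • x - (z - (1/2:ℝ) • x) := by module
    have e' : z = (1/2:ℝ) • x + (z - (1/2:ℝ) • x) := by module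
    have a1 := norm_sub_le ((1/2:ℝ) • x) (z - (1/2:ℝ) • x)
    have a2 := norm_sub_norm_le ((1/2:ℝ) • x) (z - (1/2:ℝ) • x)
    have a3 := norm_add_le ((1/2:ℝ) • x) (z - (1/2:ℝ) • x)
    have a4 := norm_sub_norm_le ((1/2:ℝ) • x) (-(z - (1/2:ℝ) • x))
    rw [norm_neg, sub_neg_eq_add] at a4
    rw [← e] at a1 a2
    rw [← e'] at a3 a4
    refine ⟨⟨?_, ?_⟩, ?_, ?_⟩ <;> linarith
  have hBS : B ⊆ S := fun z hz => by
    have := hBz z hz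
    exact ⟨by rw [norm_sub_rev]; exact this.1.1, this.2.1⟩
  have hBV : volume.real B = V := by
    rw [hVdef, Measure.real, hB, Measure.addHaar_ball_center]
  set L := Real.exp (-(a * (θ * R) ^ β)) * (1 + θ * R) ^ (-γ) with hL
  have hL0 : 0 ≤ L := by
    have : 0 ≤ 1 + θ * R := by nlinarith
    positivity
  have hmain : L * L * V ≤ ∫ z in S, ν (x - z) * ν z := by
    calc L * L * V ≤ ∫ z in B, ν (x - z) * ν z := by
          rw [← hBV]
          refine setIntegral_ge_of_const_le_real Metric.isOpen_ball.measurableSet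
            measure_ball_lt_top.ne ?_ (hint.mono_set hBS)
          intro z hz
          obtain ⟨⟨b1, b2⟩, b3, b4⟩ := hBz z hz
          exact mul_le_mul (hlb _ _ (by linarith) b2) (hlb _ _ (by linarith) b4) hL0 (hν0 _)
      _ ≤ _ := setIntegral_mono_set hint
          (Filter.Eventually.of_forall fun z => mul_nonneg (hν0 _) (hν0 _))
          (Filter.Eventually.of_forall hBS)
  refine lt_of_lt_of_le ?_ hmain
  -- final comparison
  have hνx : ν x ≤ Real.exp (-(a * R ^ β)) * (1 + R) ^ ((d:ℝ) + δ) := by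
    rw [hν, hxn, mul_assoc]
    have h1 : R ^ (-(d : ℝ) - δ) ≤ 1 :=
      Real.rpow_le_one_of_one_le_of_nonpos (by linarith)
        (by have : (0:ℝ) ≤ d := by positivity
            linarith)
    have h2 : (1 + R) ^ ((d : ℝ) + δ - γ) ≤ (1 + R) ^ ((d:ℝ) + δ) :=
      Real.rpow_le_rpow_of_exponent_le (by linarith) (by linarith)
    gcongr
    calc _ ≤ 1 * (1 + R) ^ ((d:ℝ) + δ) := by gcongr
      _ = _ := one_mul _
  have hLL : Real.exp (-(a * (θ ^ β * R ^ β))) * (1 + R) ^ (-γ) ≤ L := by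
    rw [hL, Real.mul_rpow (by linarith) hR0]
    have : (1 + R) ^ (-γ) ≤ (1 + θ * R) ^ (-γ) :=
      Real.rpow_le_rpow_of_nonpos (by nlinarith) (by nlinarith) (by linarith)
    gcongr
  have hRβ := aux_pow β R hβ hR0
  set M := Real.exp (-(a * (θ ^ β * R ^ β))) * (1 + R) ^ (-γ) with hM
  have hM0 : 0 < M := by positivity
  have key : Real.exp (-(a * R ^ β)) * (1 + R) ^ ((d:ℝ) + δ) ≤
      M * M * (Real.exp (-(a * (1 - 2 * θ ^ β) * (R - 1))) * (1 + R) ^ ((d:ℝ) + δ + 2 * γ)) := by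
    have e1 : (1 + R) ^ ((d:ℝ) + δ) =
        (1 + R) ^ (-γ) * (1 + R) ^ (-γ) * (1 + R) ^ ((d:ℝ) + δ + 2 * γ) := by
      rw [← Real.rpow_add (by positivity), ← Real.rpow_add (by positivity)]; ring_nf
    have e2 : Real.exp (-(a * R ^ β)) ≤ Real.exp (-(a * (θ ^ β * R ^ β))) *
        Real.exp (-(a * (θ ^ β * R ^ β))) * Real.exp (-(a * (1 - 2 * θ ^ β) * (R - 1))) := by
      rw [← Real.exp_add, ← Real.exp_add]
      apply Real.exp_le_exp.2
      have := mul_le_mul_of_nonneg_left hRβ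
        (mul_pos ha (by linarith : 0 < 1 - 2 * θ ^ β)).le
      linarith
    rw [e1]
    calc _ ≤ (Real.exp (-(a * (θ ^ β * R ^ β))) *
        Real.exp (-(a * (θ ^ β * R ^ β))) * Real.exp (-(a * (1 - 2 * θ ^ β) * (R - 1)))) *
        ((1 + R) ^ (-γ) * (1 + R) ^ (-γ) * (1 + R) ^ ((d:ℝ) + δ + 2 * γ)) := by gcongr
      _ = _ := by rw [hM]; ring
  calc C * ν x ≤ C * (M * M * (Real.exp (-(a * (1 - 2 * θ ^ β) * (R - 1))) *
        (1 + R) ^ ((d:ℝ) + δ + 2 * γ))) := by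
          have := hνx.trans key
          gcongr
    _ = M * M * (C * (Real.exp (-(a * (1 - 2 * θ ^ β) * (R - 1))) *
        (1 + R) ^ ((d:ℝ) + δ + 2 * γ))) := by ring
    _ < M * M * V := by gcongr
    _ ≤ L * L * V := by gcongr
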